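/- arXiv:2105.14267 — 2 statements merged into one kernel-verified Lean document; each statement's English description precedes it below -/
import Mathlib

section
/- There is an absolute constant C₁ > 0 such that for all integers 1 ≤ s ≤ d, there exists a finite set I of k = ⌈C₁ · s · log(e·d/s)⌉ vectors x⁽¹⁾,…,x⁽ᵏ⁾ ∈ ℝ^d whose first d−1 coordinates each lie in {−1, +1} and whose last coordinate equals 1, such that the normalized empirical covariance matrix Σ̂ = (1/k) Σ_{t=1}^k x⁽ᵗ⁾ (x⁽ᵗ⁾)ᵀ satisfies φ²(Σ̂, s, 3) ≥ 1/4, i.e., its restricted minimum eigenvalue with sparsity s and cone constant 3 is at least 1/4. -/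
open Finset Matrix

/-- The sign attached to a boolean. -/
noncomputable def sgn (b : Bool) : ℝ := if b then 1 else -1

lemma sgn_sq (b : Bool) : sgn b ^ 2 = 1 := by cases b <;> simp [sgn]

lemma sgn_mul_cases (a b : Bool) : sgn a * sgn b = 1 ∨ sgn a * sgn b = -1 := by
  cases a <;> cases b <;> simp [sgn]

/-- Inner product of a sign pattern with a vector. -/
noncomputable def ip {d : ℕ} (x : Fin d → Bool) (w : Fin d → ℝ) : ℝ := ∑ j, sgn (x j) * w j

lemma sum_fin_cons {α : Type*} [Fintype α] {d : ℕ} (F : (Fin (d+1) → α) → ℝ) :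
    ∑ x, F x = ∑ b : α, ∑ y : Fin d → α, F (Fin.cons b y) := by
  rw [← Fintype.sum_prod_type' (f := fun b y => F (Fin.cons b y))]
  exact (Fintype.sum_equiv (Fin.consEquiv (fun _ => α)) _ _ (fun _ => rfl)).symm

lemma ip_cons {d : ℕ} (b : Bool) (y : Fin d → Bool) (w : Fin (d+1) → ℝ) :
    ip (Fin.cons b y : Fin (d+1) → Bool) w = sgn b * w 0 + ip y (fun j => w j.succ) := by
  simp [ip, Fin.sum_univ_succ]

lemma second_moment {d : ℕ} (w : Fin d → ℝ) :
    ∑ x : Fin d → Bool, ip x w ^ 2 = 2 ^ d * ∑ j, w j ^ 2 := by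
  induction d with
  | zero => simp [ip]
  | succ d ih =>
    rw [sum_fin_cons, Fin.sum_univ_succ]
    simp only [ip_cons]
    rw [Fintype.sum_bool, ← Finset.sum_add_distrib]
    have : ∀ y : Fin d → Bool, (sgn true * w 0 + ip y (fun j => w j.succ)) ^ 2 +
      (sgn false * w 0 + ip y (fun j => w j.succ)) ^ 2 =
        2 * w 0 ^ 2 + 2 * ip y (fun j => w j.succ) ^ 2 := by
      intro y; simp [sgn]; ring
    simp only [this, Finset.sum_add_distrib, ← Finset.mul_sum, ih]
    simp
    ring

lemma fourth_moment {d : ℕ} (w : Fin d → ℝ) :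
    ∑ x : Fin d → Bool, ip x w ^ 4 ≤ 3 * 2 ^ d * (∑ j, w j ^ 2) ^ 2 := by
  induction d with
  | zero => simp [ip]
  | succ d ih =>
    rw [sum_fin_cons, Fin.sum_univ_succ]
    simp only [ip_cons]
    rw [Fintype.sum_bool, ← Finset.sum_add_distrib]
    have : ∀ y : Fin d → Bool, (sgn true * w 0 + ip y (fun j => w j.succ)) ^ 4 +
      (sgn false * w 0 + ip y (fun j => w j.succ)) ^ 4 =
        2 * w 0 ^ 4 + (12 * w 0 ^ 2) * ip y (fun j => w j.succ) ^ 2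
          + 2 * ip y (fun j => w j.succ) ^ 4 := by
      intro y; simp [sgn]; ring
    simp only [this, Finset.sum_add_distrib, ← Finset.mul_sum, second_moment]
    have h := ih (fun j => w j.succ)
    simp only [Finset.sum_const, Finset.card_univ, Fintype.card_pi, Fintype.card_bool,
      Finset.prod_const, Fintype.card_fin, nsmul_eq_mul, Nat.cast_pow, Nat.cast_ofNat]
    have h2 : 0 ≤ (2:ℝ) ^ d * w 0 ^ 4 := by positivity
    rw [pow_succ (2:ℝ) d]
    generalize (∑ x : Fin d, w x.succ ^ 2) = N at *
    nlinarith

lemma exp_neg_le_quad {u : ℝ} (hu : 0 ≤ u) : Real.exp (-u) ≤ 1 - u + u ^ 2 / 2 := by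
  have h := Real.quadratic_le_exp_of_nonneg hu
  have hq : 0 ≤ 1 - u + u ^ 2 / 2 := by nlinarith [sq_nonneg (u - 1)]
  rw [Real.exp_neg, inv_le_iff_one_le_mul₀ (Real.exp_pos _)]
  calc (1:ℝ) ≤ (1 - u + u ^ 2 / 2) * (1 + u + u ^ 2 / 2) := by nlinarith [sq_nonneg (u^2)]
    _ ≤ _ := mul_le_mul_of_nonneg_left h hq

lemma row_mgf {d : ℕ} (w : Fin d → ℝ) (hN : 0 < ∑ j, w j ^ 2) :
    ∑ x : Fin d → Bool, Real.exp (-(ip x w ^ 2 / (6 * ∑ j, w j ^ 2)))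
      ≤ 2 ^ d * Real.exp (-(1/8)) := by
  have h2 := second_moment w
  have h4 := fourth_moment w
  generalize (∑ j, w j ^ 2) = N at *
  calc ∑ x : Fin d → Bool, Real.exp (-(ip x w ^ 2 / (6 * N)))
      ≤ ∑ x : Fin d → Bool, (1 - 1 / (6 * N) * ip x w ^ 2 + 1 / (72 * N ^ 2) * ip x w ^ 4) := by
        refine Finset.sum_le_sum fun x _ => ?_
        refine (exp_neg_le_quad (by positivity)).trans (le_of_eq ?_)
        field_simp
        ring
    _ = 2 ^ d - 1 / (6 * N) * (2 ^ d * N) + 1 / (72 * N ^ 2) * ∑ x : Fin d → Bool, ip x w ^ 4 := by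
        rw [Finset.sum_add_distrib, Finset.sum_sub_distrib, ← Finset.mul_sum, ← Finset.mul_sum, h2]
        simp
    _ ≤ 2 ^ d - 1 / (6 * N) * (2 ^ d * N) + 1 / (72 * N ^ 2) * (3 * 2 ^ d * N ^ 2) := by gcongr
    _ = 2 ^ d * (-(1/8) + 1) := by field_simp; ring
    _ ≤ _ := by gcongr; exact Real.add_one_le_exp _

lemma bad_card {d k : ℕ} (w : Fin d → ℝ) :
    ((Finset.univ.filter fun X : Fin k → Fin d → Bool =>
      ∑ t, ip (X t) w ^ 2 < k / 2 * ∑ j, w j ^ 2).card : ℝ)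
      ≤ (2 ^ d) ^ k * Real.exp (-(k / 24)) := by
  rcases (Finset.sum_nonneg (fun j (_ : j ∈ Finset.univ) => sq_nonneg (w j))).eq_or_lt with h0 | hN
  · rw [← h0, Finset.filter_false_of_mem]
    · simp; positivity
    · intro X _
      simp only [mul_zero, not_lt]
      positivity
  have hr := row_mgf w hN
  generalize hNN : (∑ j, w j ^ 2) = N at *
  set B := (Finset.univ.filter fun X : Fin k → Fin d → Bool =>
      ∑ t, ip (X t) w ^ 2 < k / 2 * N) with hB
  have h1 : (B.card : ℝ) * Real.exp (-(k / 12)) ≤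
      ∑ X : Fin k → Fin d → Bool, ∏ t, Real.exp (-(ip (X t) w ^ 2 / (6 * N))) := by
    rw [← nsmul_eq_mul, ← Finset.sum_const]
    refine (Finset.sum_le_sum fun X hX => ?_).trans
      (Finset.sum_le_sum_of_subset_of_nonneg (Finset.subset_univ B) ?_)
    · rw [← Real.exp_sum, Real.exp_le_exp, Finset.sum_neg_distrib, ← Finset.sum_div, neg_le_neg_iff,
        div_le_iff₀ (by positivity)]
      have := (Finset.mem_filter.1 hX).2
      linarith
    · intros; positivity
  rw [← Fintype.sum_pow (fun x : Fin d → Bool => Real.exp (-(ip x w ^ 2 / (6 * N)))) k] at h1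
  have h2 := h1.trans (pow_le_pow_left₀ (Finset.sum_nonneg fun _ _ => (Real.exp_pos _).le) hr k)
  rw [mul_pow, ← Real.exp_nat_mul] at h2
  rw [← mul_le_mul_iff_left₀ (Real.exp_pos (-(k/12 : ℝ))), mul_assoc, ← Real.exp_add]
  convert h2 using 3
  ring

/-! Maurey sampling -/

lemma samp_one {α : Type*} [Fintype α] (p : α → ℝ) (hp : ∑ a, p a = 1) (m : ℕ) :
    ∑ f : Fin m → α, ∏ i, p (f i) = 1 := by
  rw [← Fintype.sum_pow, hp, one_pow]

lemma samp_mean {α : Type*} [Fintype α] (p h : α → ℝ) (hp : ∑ a, p a = 1) (m : ℕ) :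
    ∑ f : Fin m → α, (∏ i, p (f i)) * ∑ i, h (f i) = m * ∑ a, p a * h a := by
  induction m with
  | zero => simp
  | succ m ih =>
    rw [sum_fin_cons]
    simp only [Fin.prod_univ_succ, Fin.sum_univ_succ, Fin.cons_zero, Fin.cons_succ]
    have : ∀ (b : α) (y : Fin m → α), p b * (∏ i, p (y i)) * (h b + ∑ i, h (y i)) =
      (p b * h b) * (∏ i, p (y i)) + p b * ((∏ i, p (y i)) * ∑ i, h (y i)) := by intros; ring
    simp only [this, Finset.sum_add_distrib, ← Finset.mul_sum, ih, samp_one p hp,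
      ← Finset.sum_mul, hp]
    push_cast; ring

lemma samp_sq {α : Type*} [Fintype α] (p h : α → ℝ) (hp : ∑ a, p a = 1) (m : ℕ) :
    ∑ f : Fin m → α, (∏ i, p (f i)) * (∑ i, h (f i)) ^ 2 =
      m * ∑ a, p a * h a ^ 2 + m * (m - 1) * (∑ a, p a * h a) ^ 2 := by
  induction m with
  | zero => simp
  | succ m ih =>
    rw [sum_fin_cons]
    simp only [Fin.prod_univ_succ, Fin.sum_univ_succ, Fin.cons_zero, Fin.cons_succ]
    have : ∀ (b : α) (y : Fin m → α), p b * (∏ i, p (y i)) * (h b + ∑ i, h (y i)) ^ 2 =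
      (p b * h b ^ 2) * (∏ i, p (y i)) + (2 * (p b * h b)) * ((∏ i, p (y i)) * ∑ i, h (y i))
        + p b * ((∏ i, p (y i)) * (∑ i, h (y i)) ^ 2) := by intros; ring
    simp only [this, Finset.sum_add_distrib, ← Finset.mul_sum, ih, samp_one p hp,
      samp_mean p h hp, ← Finset.sum_mul, hp]
    push_cast; ring

/-- The signed basis vector. -/
noncomputable def sv {d : ℕ} (a : Fin d × Bool) (j : Fin d) : ℝ := if j = a.1 then sgn a.2 else 0

/-- The integer vector attached to a multiset. -/
noncomputable def wv {d m : ℕ} (σ : Sym (Fin d × Bool) m) (j : Fin d) : ℝ :=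
  ((σ : Multiset (Fin d × Bool)).map fun a => sv a j).sum

lemma ip_sv {d : ℕ} (x : Fin d → Bool) (a : Fin d × Bool) :
    ip x (sv a) = sgn (x a.1) * sgn a.2 := by
  simp [ip, sv]

lemma maurey {d m k : ℕ} (X : Fin k → Fin d → Bool) (hm : 1 ≤ m)
    (hX : ∀ σ : Sym (Fin d × Bool) m,
      (k : ℝ) / 2 * ∑ j, wv σ j ^ 2 ≤ ∑ t, ip (X t) (wv σ) ^ 2)
    (θ : Fin d → ℝ) (hT : 0 < ∑ j, |θ j|) :
    (k : ℝ) / 2 * (m - 1) * ∑ j, θ j ^ 2 ≤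
      (m - 1) * ∑ t, ip (X t) θ ^ 2 + k / 2 * (∑ j, |θ j|) ^ 2 := by
  set T := ∑ j, |θ j| with hTdef
  let p : Fin d × Bool → ℝ := fun a => max (sgn a.2 * θ a.1) 0 / T
  have hp0 : ∀ a, 0 ≤ p a := fun a => by positivity
  have hpT : ∀ j : Fin d, p (j, true) + p (j, false) = |θ j| / T := by
    intro j
    simp only [p, sgn, ← add_div]
    congr 1
    rcases le_total 0 (θ j) with h | h
    · simp [h, abs_of_nonneg]
    · simp [h, abs_of_nonpos]
  have hpS : ∀ j : Fin d, p (j, true) - p (j, false) = θ j / T := by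
    intro j
    simp only [p, sgn, ← sub_div]
    congr 1
    rcases le_total 0 (θ j) with h | h
    · simp [h]
    · simp [h]
  have hp : ∑ a, p a = 1 := by
    rw [Fintype.sum_prod_type]
    simp only [Fintype.sum_bool, hpT, ← Finset.sum_div]
    exact div_self hT.ne'
  have key : ∀ f : Fin m → Fin d × Bool,
      (k : ℝ) / 2 * ∑ j, (∑ i, sv (f i) j) ^ 2 ≤ ∑ t, (∑ i, ip (X t) (sv (f i))) ^ 2 := by
    intro f
    have h := hX ⟨Finset.univ.val.map f, by simp⟩
    have hw : (wv (⟨Finset.univ.val.map f, by simp⟩ : Sym (Fin d × Bool) m) : Fin d → ℝ) = fun j => ∑ i, sv (f i) j := by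
      funext j
      simp only [wv, Sym.coe_mk, Multiset.map_map]
      rfl
    rw [hw] at h
    convert h using 3 with t _
    simp only [ip, Finset.mul_sum]
    rw [Finset.sum_comm]
  have avg : ∑ f : Fin m → Fin d × Bool, (∏ i, p (f i)) *
        ((k : ℝ) / 2 * ∑ j, (∑ i, sv (f i) j) ^ 2) ≤
      ∑ f : Fin m → Fin d × Bool, (∏ i, p (f i)) * ∑ t, (∑ i, ip (X t) (sv (f i))) ^ 2 :=
    Finset.sum_le_sum fun f _ =>
      mul_le_mul_of_nonneg_left (key f) (Finset.prod_nonneg fun _ _ => hp0 _)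
  have mean1 : ∀ j, ∑ a, p a * sv a j = θ j / T := by
    intro j
    rw [Fintype.sum_prod_type]
    simp only [Fintype.sum_bool, sv, ← hpS]
    simp only [mul_ite, mul_zero, Finset.sum_add_distrib, Finset.sum_ite_eq, Finset.mem_univ, if_true]
    simp [sgn]; ring
  have mean2 : ∀ t, ∑ a, p a * ip (X t) (sv a) = ip (X t) θ / T := by
    intro t
    rw [Fintype.sum_prod_type]
    simp only [Fintype.sum_bool, ip_sv]
    simp only [ip, Finset.sum_div]
    refine Finset.sum_congr rfl fun j _ => ?_
    rw [mul_div_assoc, ← hpS]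
    have e1 : sgn true = 1 := rfl
    have e2 : sgn false = -1 := rfl
    rw [e1, e2]; ring
  have sq1 : ∑ j, ∑ a, p a * sv a j ^ 2 = 1 := by
    rw [Finset.sum_comm, ← hp]
    refine Finset.sum_congr rfl fun a _ => ?_
    simp [sv, ← Finset.mul_sum, sgn_sq, ite_pow]
  have sq2 : ∀ t, ∑ a, p a * ip (X t) (sv a) ^ 2 = 1 := by
    intro t
    rw [← hp]
    refine Finset.sum_congr rfl fun a _ => ?_
    rw [ip_sv, mul_pow, sgn_sq, sgn_sq]; ring
  have L : ∑ f : Fin m → Fin d × Bool, (∏ i, p (f i)) *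
        ((k : ℝ) / 2 * ∑ j, (∑ i, sv (f i) j) ^ 2) =
      (k : ℝ) / 2 * (m + m * (m - 1) * ((∑ j, θ j ^ 2) / T ^ 2)) := by
    simp only [Finset.mul_sum (a := (k:ℝ)/2), Finset.mul_sum (s := (Finset.univ : Finset (Fin d)))]
    rw [Finset.sum_comm]
    have : ∀ j : Fin d, ∑ f : Fin m → Fin d × Bool, (∏ i, p (f i)) * ((k : ℝ) / 2 * (∑ i, sv (f i) j) ^ 2)
       = (k : ℝ) / 2 * (m * ∑ a, p a * sv a j ^ 2 + m * (m - 1) * (θ j ^ 2 / T ^ 2)) := by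
      intro j
      rw [← div_pow, ← mean1, ← samp_sq p (fun a => sv a j) hp m, Finset.mul_sum]
      exact Finset.sum_congr rfl fun f _ => by ring
    simp only [this]
    rw [← Finset.mul_sum, Finset.sum_add_distrib, ← Finset.mul_sum, sq1, ← Finset.mul_sum,
      ← Finset.sum_div, mul_one]
  have R : ∑ f : Fin m → Fin d × Bool, (∏ i, p (f i)) * ∑ t, (∑ i, ip (X t) (sv (f i))) ^ 2 =
      k * m + m * (m - 1) * ((∑ t, ip (X t) θ ^ 2) / T ^ 2) := by
    simp only [Finset.mul_sum (s := (Finset.univ : Finset (Fin k)))]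
    rw [Finset.sum_comm]
    have : ∀ t : Fin k, ∑ f : Fin m → Fin d × Bool, (∏ i, p (f i)) *
        (∑ i, ip (X t) (sv (f i))) ^ 2 = m + m * (m - 1) * (ip (X t) θ ^ 2 / T ^ 2) := by
      intro t
      rw [samp_sq p (fun a => ip (X t) (sv a)) hp m, sq2, mean2, div_pow, mul_one]
    simp only [this]
    rw [Finset.sum_add_distrib, ← Finset.mul_sum, ← Finset.sum_div]
    simp
  rw [L, R] at avg
  have hm0 : (0:ℝ) < m := by exact_mod_cast hm
  have hT2 : 0 < T ^ 2 := by positivity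
  generalize (∑ j, θ j ^ 2) = A at *
  generalize (∑ t, ip (X t) θ ^ 2) = Q at *
  have e1 : A / T ^ 2 * T ^ 2 = A := by field_simp
  have e2 : Q / T ^ 2 * T ^ 2 = Q := by field_simp
  have h3 := mul_le_mul_of_nonneg_right avg hT2.le
  have h4 : (m:ℝ) * ((k : ℝ) / 2 * (m - 1) * A) ≤ m * ((m - 1) * Q + k / 2 * T ^ 2) := by
    rw [← e1, ← e2]
    nlinarith
  exact le_of_mul_le_mul_left h4 hm0

lemma card_bound {s d : ℕ} (hs : 1 ≤ s) (hsd : s ≤ d) :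
    (Fintype.card (Sym (Fin d × Bool) (32 * s + 1)) : ℝ) ≤
      Real.exp (66 * (s * Real.log (Real.exp 1 * d / s))) := by
  have hs0 : (1:ℝ) ≤ s := by exact_mod_cast hs
  have hd0 : (s:ℝ) ≤ d := by exact_mod_cast hsd
  have hd1 : (0:ℝ) < d := by linarith
  set m := 32 * s + 1 with hm
  have hm0 : (0:ℝ) < m := by rw [hm]; positivity
  set L := Real.log (Real.exp 1 * d / s) with hL
  have hL' : Real.exp L = Real.exp 1 * d / s := Real.exp_log (by positivity)
  have hL1 : 1 ≤ L := by
    rw [← Real.exp_le_exp, hL', le_div_iff₀ (by positivity)]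
    gcongr
  rw [Sym.card_sym_eq_choose]
  have hcard : Fintype.card (Fin d × Bool) = 2 * d := by simp [mul_comm]
  rw [hcard]
  have hn : ((2 * d + m - 1 : ℕ) : ℝ) ≤ 34 * d := by
    have : 2 * d + m - 1 ≤ 34 * d := by omega
    exact_mod_cast this
  calc (((2 * d + m - 1).choose m : ℕ) : ℝ) ≤ ((2 * d + m - 1 : ℕ) : ℝ) ^ m / m.factorial :=
        Nat.choose_le_pow_div _ _
    _ ≤ (34 * d) ^ m / m.factorial := by gcongr
    _ = (34 * d / m) ^ m * ((m:ℝ) ^ m / m.factorial) := by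
        rw [div_pow]; field_simp
    _ ≤ (34 * d / m) ^ m * Real.exp m := by
        gcongr
        exact Real.pow_div_factorial_le_exp _ hm0.le _
    _ ≤ (2 * d / s) ^ m * Real.exp m := by
        have : 34 * (d:ℝ) / m ≤ 2 * d / s := by
          rw [div_le_div_iff₀ hm0 (by positivity), hm]
          push_cast
          nlinarith
        gcongr
    _ = (2 * (Real.exp 1 * d / s)) ^ m := by
        rw [← Real.exp_one_pow, ← mul_pow]; congr 1; ring
    _ ≤ (Real.exp L * Real.exp L) ^ m := by
        have h2 : 2 ≤ Real.exp L := by linarith [Real.add_one_le_exp L]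
        rw [← hL']
        gcongr
    _ = Real.exp (m * (2 * L)) := by rw [← Real.exp_add, ← Real.exp_nat_mul]; congr 1; ring
    _ ≤ _ := by
        rw [Real.exp_le_exp, hm]; push_cast
        nlinarith

lemma exists_good {s d k : ℕ} (hs : 1 ≤ s) (hsd : s ≤ d)
    (hk : 1600 * s * Real.log (Real.exp 1 * d / s) ≤ k) (hk0 : 0 < k) :
    ∃ X : Fin k → Fin d → Bool, ∀ σ : Sym (Fin d × Bool) (32 * s + 1),
      (k : ℝ) / 2 * ∑ j, wv σ j ^ 2 ≤ ∑ t, ip (X t) (wv σ) ^ 2 := by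
  classical
  by_contra! hcon
  have hc := card_bound hs hsd
  have hkr : (0:ℝ) < k := by exact_mod_cast hk0
  have hsub : (Finset.univ : Finset (Fin k → Fin d → Bool)) ⊆
      Finset.univ.biUnion fun σ : Sym (Fin d × Bool) (32 * s + 1) =>
        (Finset.univ.filter fun X : Fin k → Fin d → Bool =>
          ∑ t, ip (X t) (wv σ) ^ 2 < k / 2 * ∑ j, wv σ j ^ 2) := by
    intro X _
    obtain ⟨σ, h⟩ := hcon X
    simp only [Finset.mem_biUnion, Finset.mem_univ, Finset.mem_filter, true_and]
    exact ⟨σ, h⟩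
  have h1 := (Finset.card_le_card hsub).trans Finset.card_biUnion_le
  have h2 : ((2:ℝ) ^ d) ^ k ≤ ∑ σ : Sym (Fin d × Bool) (32 * s + 1),
      (((Finset.univ.filter fun X : Fin k → Fin d → Bool =>
          ∑ t, ip (X t) (wv σ) ^ 2 < k / 2 * ∑ j, wv σ j ^ 2)).card : ℝ) := by
    have : (((Finset.univ : Finset (Fin k → Fin d → Bool)).card : ℕ) : ℝ) = ((2:ℝ) ^ d) ^ k := by
      simp
    rw [← this]
    exact_mod_cast h1
  have h3 := h2.trans (Finset.sum_le_sum fun σ _ => bad_card (wv σ))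
  rw [Finset.sum_const, nsmul_eq_mul, Finset.card_univ] at h3
  have hP : (0:ℝ) < ((2:ℝ) ^ d) ^ k := by positivity
  have h4 : ((2:ℝ) ^ d) ^ k * 1 ≤ ((2:ℝ) ^ d) ^ k *
      (Real.exp (66 * (s * Real.log (Real.exp 1 * d / s))) * Real.exp (-(k / 24))) := by
    refine (mul_one _).le.trans (h3.trans ?_)
    rw [mul_left_comm]
    gcongr
  have h5 := le_of_mul_le_mul_left h4 hP
  rw [← Real.exp_add, Real.one_le_exp_iff] at h5
  linarith

/-- Existence of an informative action set: for an absolute constant `C₁ > 0` and all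
`1 ≤ s ≤ d`, there are `k = ⌈C₁ s log(ed/s)⌉` sign vectors (last coordinate `1`) whose
normalized empirical covariance has restricted minimum eigenvalue `φ²(Σ̂, s, 3) ≥ 1/4`. -/
theorem exists_informative_action_set :
    ∃ C₁ : ℝ, 0 < C₁ ∧
      ∀ s d : ℕ, ∀ (hs : 1 ≤ s) (hsd : s ≤ d),
        ∃ (k : ℕ) (x : Fin k → Fin d → ℝ),
          k = ⌈C₁ * s * Real.log (Real.exp 1 * d / s)⌉₊ ∧
          (∀ t : Fin k,
            (∀ j : Fin d, (j : ℕ) < d - 1 → x t j = 1 ∨ x t j = -1) ∧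
            x t ⟨d - 1, by omega⟩ = 1) ∧
          (∀ S : Finset (Fin d), S.card ≤ s →
            ∀ θ : Fin d → ℝ,
              (fun i => if i ∈ S then θ i else 0) ≠ 0 →
              (∑ i ∈ Sᶜ, |θ i|) ≤ 3 * ∑ i ∈ S, |θ i| →
              θ ⬝ᵥ ((k : ℝ)⁻¹ • ∑ t : Fin k, vecMulVec (x t) (x t)).mulVec θ /
                  (∑ i ∈ S, (θ i) ^ 2) ≥ 1 / 4) := by
  refine ⟨1600, by norm_num, fun s d hs hsd => ?_⟩
  have hs0 : (1:ℝ) ≤ s := by exact_mod_cast hs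
  have hd0 : (s:ℝ) ≤ d := by exact_mod_cast hsd
  have hL1 : 0 < Real.log (Real.exp 1 * d / s) := by
    apply Real.log_pos
    rw [lt_div_iff₀ (by positivity)]
    nlinarith [Real.add_one_lt_exp (one_ne_zero)]
  obtain ⟨k, hk⟩ : ∃ k, k = ⌈1600 * s * Real.log (Real.exp 1 * d / s)⌉₊ := ⟨_, rfl⟩
  have hk0 : 0 < k := by
    rw [hk, Nat.ceil_pos]; positivity
  have hk1 : 1600 * s * Real.log (Real.exp 1 * d / s) ≤ k := by
    rw [hk]; exact Nat.le_ceil _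
  have hkr : (0:ℝ) < k := by exact_mod_cast hk0
  obtain ⟨X, hX⟩ := exists_good hs hsd hk1 hk0
  let l : Fin d := ⟨d - 1, by omega⟩
  refine ⟨k, fun t j => sgn (X t l) * sgn (X t j), hk, ?_, ?_⟩
  · intro t
    constructor
    · intro j _
      exact sgn_mul_cases _ _
    · change sgn (X t l) * sgn (X t l) = 1
      rw [← pow_two, sgn_sq]
  intro S hS θ hne hcone
  have hquad : θ ⬝ᵥ ((k : ℝ)⁻¹ • ∑ t : Fin k, vecMulVec (fun j => sgn (X t l) * sgn (X t j))
      (fun j => sgn (X t l) * sgn (X t j))).mulVec θ = (k:ℝ)⁻¹ * ∑ t, ip (X t) θ ^ 2 := by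
    rw [Matrix.smul_mulVec, dotProduct_smul, smul_eq_mul, Matrix.sum_mulVec, dotProduct_sum]
    congr 1
    refine Finset.sum_congr rfl fun t _ => ?_
    have e : (fun j => sgn (X t l) * sgn (X t j)) ⬝ᵥ θ = sgn (X t l) * ip (X t) θ := by
      simp [dotProduct, ip, Finset.mul_sum, mul_assoc]
    rw [Matrix.vecMulVec_mulVec, dotProduct_smul, dotProduct_comm θ, e]
    simp only [MulOpposite.smul_eq_mul_unop, MulOpposite.unop_op]
    rw [← pow_two, mul_pow, sgn_sq, one_mul]
  rw [hquad]
  have hB : 0 < ∑ i ∈ S, θ i ^ 2 := by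
    obtain ⟨i, hi⟩ := Function.ne_iff.1 hne
    have hiS : i ∈ S := by by_contra h; simp [h] at hi
    have hi0 : θ i ≠ 0 := by simpa [hiS] using hi
    exact Finset.sum_pos' (fun _ _ => sq_nonneg _) ⟨i, hiS, by positivity⟩
  have hCS : (∑ i ∈ S, |θ i|) ^ 2 ≤ s * ∑ i ∈ S, θ i ^ 2 := by
    have h := sq_sum_le_card_mul_sum_sq (s := S) (f := fun i => |θ i|)
    simp only [sq_abs] at h
    refine h.trans ?_
    gcongr
  have hsplit := Finset.sum_add_sum_compl S (fun i => |θ i|)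
  have hA : ∑ i ∈ S, θ i ^ 2 ≤ ∑ i, θ i ^ 2 :=
    Finset.sum_le_sum_of_subset_of_nonneg (Finset.subset_univ _) fun _ _ _ => sq_nonneg _
  have hT : 0 < ∑ i, |θ i| := by
    refine (Finset.sum_nonneg fun _ _ => abs_nonneg _).lt_of_ne fun h => ?_
    have h0 := (Finset.sum_eq_zero_iff_of_nonneg (fun _ _ => abs_nonneg _)).1 h.symm
    apply hB.ne'
    refine Finset.sum_eq_zero fun i _ => ?_
    have := h0 i (Finset.mem_univ _)
    rw [abs_eq_zero] at this
    rw [this]; norm_num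
  have hM := maurey X (by omega) hX θ hT
  have hT2 : (∑ i, |θ i|) ^ 2 ≤ 16 * (s * ∑ i ∈ S, θ i ^ 2) := by
    have : (∑ i, |θ i|) ^ 2 ≤ (4 * ∑ i ∈ S, |θ i|) ^ 2 := by
      gcongr; linarith
    nlinarith
  rw [ge_iff_le, le_div_iff₀ hB, ← mul_le_mul_iff_right₀ hkr, mul_inv_cancel_left₀ hkr.ne']
  push_cast at hM
  rw [add_sub_cancel_right] at hM
  generalize (∑ i, |θ i|) ^ 2 = T2 at *
  generalize (∑ t, ip (X t) θ ^ 2) = Q at *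
  generalize (∑ i ∈ S, θ i ^ 2) = B at *
  generalize (∑ i, θ i ^ 2) = A at *
  have h1 : (k:ℝ) / 2 * T2 ≤ k / 2 * (16 * (s * B)) := by gcongr
  have h2 : (k:ℝ) / 2 * (32 * s) * B ≤ (k:ℝ) / 2 * (32 * s) * A := by gcongr
  have h3 : (32 * s : ℝ) * (k * (1 / 4 * B)) ≤ 32 * s * Q := by nlinarith
  exact le_of_mul_le_mul_left h3 (by positivity)
end

section
/- Let 1 ≤ s ≤ d and n ≥ 1 be integers, and let a_1,…,a_n ∈ ℝ^d be fixed vectors with ‖a_t‖_∞ ≤ 1 for every t. For θ ∈ ℝ^d let P_θ = ⊗_{t=1}^n N(⟨a_t, θ⟩, 1) be the law on ℝ^n of n independent unit-variance Gaussian observations with means ⟨a_t, θ⟩. Let ρ be any probability measure supported on Θ = {θ ∈ ℝ^d : θ has at most s nonzero coordinates and ‖θ‖₂ ≤ 1}, and let P̄ = ∫ P_θ dρ(θ) be the Bayes mixture. Then the mutual information ∫ D_KL(P_θ ‖ P̄) dρ(θ) is at most 2·s·log(C·d·n^{1/2}/s) for an absolute constant C > 0 (one may take C = 3e). -/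
open MeasureTheory ProbabilityTheory Finset
open scoped Classical ENNReal

/-- Kullback–Leibler divergence between two measures, valued in `ℝ≥0∞`
(equal to `∞` when the first measure is not absolutely continuous with respect to
the second or the log-likelihood ratio is not integrable). -/
noncomputable def klDiv {Ω : Type*} [MeasurableSpace Ω] (μ ν : Measure Ω) : ENNReal :=
  if μ ≪ ν ∧ Integrable (llr μ ν) μ then ENNReal.ofReal (∫ x, llr μ ν x ∂μ) else ⊤

/-- The law on `ℝ^n` of `n` independent unit-variance Gaussian observations with
means `⟨a_t, θ⟩`. -/
noncomputable def obsLaw {d n : ℕ} (a : Fin n → Fin d → ℝ) (θ : Fin d → ℝ) :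
    Measure (Fin n → ℝ) :=
  Measure.pi fun t => gaussianReal (∑ i, a t i * θ i) 1

noncomputable def gdens {n : ℕ} (m y : Fin n → ℝ) : ℝ := ∏ t, gaussianPDFReal (m t) 1 (y t)

noncomputable def mn {d n : ℕ} (a : Fin n → Fin d → ℝ) (θ : Fin d → ℝ) (t : Fin n) : ℝ :=
  ∑ i, a t i * θ i

lemma gdens_pos {n : ℕ} (m y : Fin n → ℝ) : 0 < gdens m y :=
  Finset.prod_pos fun t _ => gaussianPDFReal_pos _ _ _ one_ne_zero

lemma gdens_eq {n : ℕ} (m y : Fin n → ℝ) :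
    gdens m y = ((Real.sqrt (2 * Real.pi))⁻¹) ^ n * Real.exp (-(∑ t, (y t - m t) ^ 2) / 2) := by
  unfold gdens gaussianPDFReal
  rw [Finset.prod_mul_distrib, ← Real.exp_sum]
  simp [Finset.sum_div, neg_div]

lemma log_gdens {n : ℕ} (m y : Fin n → ℝ) :
    Real.log (gdens m y) = Real.log (((Real.sqrt (2 * Real.pi))⁻¹) ^ n)
      - (∑ t, (y t - m t) ^ 2) / 2 := by
  rw [gdens_eq, Real.log_mul (by positivity) (by positivity), Real.log_exp]
  ring

lemma measurable_gdens {n d : ℕ} (a : Fin n → Fin d → ℝ) :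
    Measurable (fun z : (Fin d → ℝ) × (Fin n → ℝ) => gdens (mn a z.1) z.2) := by
  simp only [gdens_eq, mn]
  fun_prop

lemma measurable_gdens_right {n : ℕ} (m : Fin n → ℝ) : Measurable (gdens m) := by
  have : gdens m = fun y => gdens m y := rfl
  rw [this]
  simp only [gdens_eq]
  fun_prop

lemma pi_gaussian_eq {n : ℕ} (m : Fin n → ℝ) :
    (Measure.pi fun t => gaussianReal (m t) 1) =
      volume.withDensity fun y => ENNReal.ofReal (gdens m y) := by
  apply Measure.pi_eq
  intro S hS
  rw [withDensity_apply _ (MeasurableSet.univ_pi hS), volume_pi, Measure.restrict_pi_pi]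
  have hint : ∀ t, Integrable (gaussianPDFReal (m t) 1) (volume.restrict (S t)) := fun t =>
    (integrable_gaussianPDFReal _ _).integrableOn
  unfold gdens
  rw [← ofReal_integral_eq_lintegral_ofReal]
  · rw [integral_fintype_prod_eq_prod (μ := fun t => volume.restrict (S t))
      (fun t => gaussianPDFReal (m t) 1), ENNReal.ofReal_prod_of_nonneg]
    · refine Finset.prod_congr rfl fun t _ => ?_
      rw [gaussianReal_apply_eq_integral _ one_ne_zero]
    · intro t _
      exact integral_nonneg fun x => gaussianPDFReal_nonneg _ _ _
  · exact Integrable.fintype_prod hint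
  · exact Filter.Eventually.of_forall fun y => (gdens_pos m y).le

lemma obsLaw_eq {d n : ℕ} (a : Fin n → Fin d → ℝ) (θ : Fin d → ℝ) :
    obsLaw a θ = volume.withDensity fun y => ENNReal.ofReal (gdens (mn a θ) y) :=
  pi_gaussian_eq (mn a θ)

instance obsLaw_prob {d n : ℕ} (a : Fin n → Fin d → ℝ) (θ : Fin d → ℝ) :
    IsProbabilityMeasure (obsLaw a θ) := by
  unfold obsLaw; infer_instance

lemma lintegral_gdens {n : ℕ} (m : Fin n → ℝ) :
    ∫⁻ y, ENNReal.ofReal (gdens m y) = 1 := by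
  have h : (Measure.pi fun t => gaussianReal (m t) 1) Set.univ = 1 := measure_univ
  rw [pi_gaussian_eq, withDensity_apply _ MeasurableSet.univ, Measure.restrict_univ] at h
  exact h

lemma measurable_obsLaw {d n : ℕ} (a : Fin n → Fin d → ℝ) : Measurable (obsLaw a) := by
  refine Measure.measurable_of_measurable_coe _ fun S hS => ?_
  simp_rw [obsLaw_eq, withDensity_apply _ hS]
  exact (measurable_gdens a).ennreal_ofReal.lintegral_prod_right'

noncomputable def pbar {d n : ℕ} (a : Fin n → Fin d → ℝ) (ρ : Measure (Fin d → ℝ))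
    (y : Fin n → ℝ) : ℝ := ∫ θ, gdens (mn a θ) y ∂ρ

lemma gdens_le {n : ℕ} (m y : Fin n → ℝ) : gdens m y ≤ ((Real.sqrt (2 * Real.pi))⁻¹) ^ n := by
  rw [gdens_eq]
  refine mul_le_of_le_one_right (by positivity) (Real.exp_le_one_iff.2 ?_)
  have : 0 ≤ ∑ t, (y t - m t) ^ 2 := Finset.sum_nonneg fun _ _ => sq_nonneg _
  linarith

lemma integrable_gdens {d n : ℕ} (a : Fin n → Fin d → ℝ) (ρ : Measure (Fin d → ℝ))
    [IsProbabilityMeasure ρ] (y : Fin n → ℝ) : Integrable (fun θ => gdens (mn a θ) y) ρ := by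
  refine Integrable.of_bound
    ((measurable_gdens a).comp (measurable_id.prodMk measurable_const)).aestronglyMeasurable
    (((Real.sqrt (2 * Real.pi))⁻¹) ^ n) (Filter.Eventually.of_forall fun θ => ?_)
  rw [Real.norm_of_nonneg (gdens_pos _ _).le]
  exact gdens_le _ _

lemma measurable_pbar {d n : ℕ} (a : Fin n → Fin d → ℝ) (ρ : Measure (Fin d → ℝ))
    [IsProbabilityMeasure ρ] : Measurable (pbar a ρ) := by
  have := (measurable_gdens a).stronglyMeasurable.integral_prod_left' (μ := ρ)
  exact this.measurable

lemma ofReal_pbar {d n : ℕ} (a : Fin n → Fin d → ℝ) (ρ : Measure (Fin d → ℝ))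
    [IsProbabilityMeasure ρ] (y : Fin n → ℝ) :
    ENNReal.ofReal (pbar a ρ y) = ∫⁻ θ, ENNReal.ofReal (gdens (mn a θ) y) ∂ρ :=
  ofReal_integral_eq_lintegral_ofReal (integrable_gdens a ρ y)
    (Filter.Eventually.of_forall fun θ => (gdens_pos _ _).le)

lemma bind_eq {d n : ℕ} (a : Fin n → Fin d → ℝ) (ρ : Measure (Fin d → ℝ))
    [IsProbabilityMeasure ρ] :
    ρ.bind (obsLaw a) = volume.withDensity fun y => ENNReal.ofReal (pbar a ρ y) := by
  ext S hS
  rw [Measure.bind_apply hS (measurable_obsLaw a).aemeasurable, withDensity_apply _ hS]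
  simp_rw [obsLaw_eq, withDensity_apply _ hS, ofReal_pbar]
  exact lintegral_lintegral_swap (measurable_gdens a).ennreal_ofReal.aemeasurable

lemma bind_prob {d n : ℕ} (a : Fin n → Fin d → ℝ) (ρ : Measure (Fin d → ℝ))
    [IsProbabilityMeasure ρ] : IsProbabilityMeasure (ρ.bind (obsLaw a)) := by
  constructor
  rw [Measure.bind_apply MeasurableSet.univ (measurable_obsLaw a).aemeasurable]
  simp

/-- core KL bound -/
lemma kl_core {Ω : Type*} [MeasurableSpace Ω] (vol μ ν : Measure Ω) [SigmaFinite vol]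
    [IsProbabilityMeasure μ] [IsProbabilityMeasure ν]
    (f g q h : Ω → ℝ) (hf : Measurable f) (hg : Measurable g) (hq : Measurable q)
    (hf0 : ∀ x, 0 < f x) (hg0 : ∀ x, 0 < g x) (hq0 : ∀ x, 0 ≤ q x)
    (hμ : μ = vol.withDensity fun x => ENNReal.ofReal (f x))
    (hν : ν = vol.withDensity fun x => ENNReal.ofReal (g x))
    (hint : Integrable (fun x => Real.log (f x) - Real.log (g x)) μ)
    (hh : Integrable h μ)
    (hle : ∀ x, Real.log (f x) - Real.log (g x) ≤ h x + (q x / g x - 1))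
    (B : ℝ) (hB0 : 0 ≤ B) (hB : ∫ x, h x ∂μ ≤ B) :
    klDiv μ ν + 1 ≤ ENNReal.ofReal B + ∫⁻ x, ENNReal.ofReal (q x / g x) ∂μ := by
  have hr : μ = ν.withDensity fun x => ENNReal.ofReal (f x / g x) := by
    rw [hμ, hν, ← withDensity_mul _ (by fun_prop) (by fun_prop)]
    congr 1
    ext x
    simp only [Pi.mul_apply]
    rw [← ENNReal.ofReal_mul (hg0 x).le, mul_div_cancel₀ _ (hg0 x).ne']
  have hac : μ ≪ ν := by
    rw [hr]; exact withDensity_absolutelyContinuous _ _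
  have hrn : μ.rnDeriv ν =ᵐ[ν] fun x => ENNReal.ofReal (f x / g x) := by
    conv_lhs => rw [hr]
    exact Measure.rnDeriv_withDensity ν (by fun_prop)
  have hllr : llr μ ν =ᵐ[μ] fun x => Real.log (f x) - Real.log (g x) := by
    filter_upwards [hac.ae_le hrn] with x hx
    rw [llr, hx, ENNReal.toReal_ofReal (div_pos (hf0 x) (hg0 x)).le,
      Real.log_div (hf0 x).ne' (hg0 x).ne']
  have hllri : Integrable (llr μ ν) μ := hint.congr hllr.symm
  have hgibbs := InformationTheory.integral_llr_add_sub_measure_univ_nonneg hac hllri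
  simp only [probReal_univ, add_sub_cancel_right] at hgibbs
  rw [klDiv, if_pos ⟨hac, hllri⟩]
  by_cases htop : ∫⁻ x, ENNReal.ofReal (q x / g x) ∂μ = ⊤
  · simp [htop]
  have hqg0 : ∀ x, 0 ≤ q x / g x := fun x => div_nonneg (hq0 x) (hg0 x).le
  have hqi : Integrable (fun x => q x / g x) μ := by
    refine ⟨(hq.div hg).aestronglyMeasurable, ?_⟩
    rw [hasFiniteIntegral_iff_ofReal (Filter.Eventually.of_forall hqg0)]
    exact lt_top_iff_ne_top.2 htop
  rw [← ofReal_integral_eq_lintegral_ofReal hqi (Filter.Eventually.of_forall hqg0),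
    ← ENNReal.ofReal_add hB0 (integral_nonneg hqg0), ← ENNReal.ofReal_one,
    ← ENNReal.ofReal_add hgibbs zero_le_one]
  apply ENNReal.ofReal_le_ofReal
  rw [integral_congr_ae hllr]
  have h1 : ∫ x, (Real.log (f x) - Real.log (g x)) ∂μ ≤ ∫ x, (h x + (q x / g x - 1)) ∂μ :=
    integral_mono hint (hh.add (hqi.sub (integrable_const 1))) hle
  have h2 : ∫ x, (h x + (q x / g x - 1)) ∂μ = ∫ x, h x ∂μ + (∫ x, q x / g x ∂μ - 1) := by
    have h3 : Integrable (fun x => q x / g x - 1) μ := hqi.sub (integrable_const 1)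
    rw [integral_add hh h3, integral_sub hqi (integrable_const 1)]
    simp
  rw [h2] at h1
  linarith

lemma integrable_quad {n : ℕ} (m c : Fin n → ℝ) :
    Integrable (fun y : Fin n → ℝ => ∑ t, (y t - c t) ^ 2)
      (Measure.pi fun t => gaussianReal (m t) 1) := by
  refine integrable_finsetSum _ fun t _ => ?_
  refine integrable_comp_eval (μ := fun t => gaussianReal (m t) 1) (i := t)
    (f := fun x => (x - c t) ^ 2) ?_
  have h : MemLp (fun x : ℝ => x - c t) 2 (gaussianReal (m t) 1) :=
    (memLp_id_gaussianReal' 2 (by simp)).sub (memLp_const _)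
  exact h.integrable_sq

lemma integrable_log_ratio {n : ℕ} (m m' : Fin n → ℝ) :
    Integrable (fun y : Fin n → ℝ => Real.log (gdens m y) - Real.log (gdens m' y))
      (Measure.pi fun t => gaussianReal (m t) 1) := by
  have h := ((integrable_quad m m').div_const 2).sub ((integrable_quad m m).div_const 2)
  refine h.congr (Filter.Eventually.of_forall fun y => ?_)
  simp only [log_gdens, Pi.sub_apply]
  ring

lemma integral_log_ratio {n : ℕ} (m m' : Fin n → ℝ) :
    ∫ y : Fin n → ℝ, (Real.log (gdens m y) - Real.log (gdens m' y))
      ∂(Measure.pi fun t => gaussianReal (m t) 1) = (∑ t, (m t - m' t) ^ 2) / 2 := by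
  have e : ∀ y : Fin n → ℝ, Real.log (gdens m y) - Real.log (gdens m' y) =
      ∑ t, ((m t - m' t) * y t + (m' t ^ 2 - m t ^ 2) / 2) := by
    intro y
    rw [log_gdens, log_gdens]
    have : ∑ t, (y t - m' t) ^ 2 / 2 - ∑ t, (y t - m t) ^ 2 / 2 =
      ∑ t, ((m t - m' t) * y t + (m' t ^ 2 - m t ^ 2) / 2) := by
      rw [← Finset.sum_sub_distrib]
      refine Finset.sum_congr rfl fun t _ => ?_
      ring
    rw [← this, Finset.sum_div, Finset.sum_div]
    ring
  simp_rw [e]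
  have hi : ∀ t, Integrable (fun y : Fin n → ℝ => y t)
      (Measure.pi fun t => gaussianReal (m t) 1) := fun t =>
    integrable_eval (μ := fun t => gaussianReal (m t) 1)
      ((memLp_id_gaussianReal' 1 (by simp)).integrable le_rfl)
  have hi2 : ∀ t, Integrable (fun y : Fin n → ℝ => (m t - m' t) * y t +
      (m' t ^ 2 - m t ^ 2) / 2) (Measure.pi fun t => gaussianReal (m t) 1) := fun t =>
    ((hi t).const_mul _).add (integrable_const _)
  rw [integral_finsetSum _ fun t _ => hi2 t, Finset.sum_div]
  refine Finset.sum_congr rfl fun t _ => ?_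
  rw [integral_add ((hi t).const_mul _) (integrable_const _), integral_const_mul]
  have := integral_eval (μ := fun t => gaussianReal (m t) 1) (i := t)
  rw [this, integral_id_gaussianReal]
  simp
  ring

lemma pbar_le {d n : ℕ} (a : Fin n → Fin d → ℝ) (ρ : Measure (Fin d → ℝ))
    [IsProbabilityMeasure ρ] (y : Fin n → ℝ) :
    pbar a ρ y ≤ ((Real.sqrt (2 * Real.pi))⁻¹) ^ n := by
  have := integral_mono (integrable_gdens a ρ y) (integrable_const _)
    (fun θ => gdens_le (mn a θ) y)
  simpa [pbar] using this

lemma le_pbar {d n : ℕ} (a : Fin n → Fin d → ℝ) (ρ : Measure (Fin d → ℝ))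
    [IsProbabilityMeasure ρ] (R : ℝ) (hR : ∀ᵐ θ ∂ρ, ∀ t, |mn a θ t| ≤ R) (y : Fin n → ℝ) :
    ((Real.sqrt (2 * Real.pi))⁻¹) ^ n * Real.exp (-(∑ t, (y t ^ 2 + R ^ 2))) ≤ pbar a ρ y := by
  have := integral_mono_ae (μ := ρ) (integrable_const
    (((Real.sqrt (2 * Real.pi))⁻¹) ^ n * Real.exp (-(∑ t, (y t ^ 2 + R ^ 2)))))
    (integrable_gdens a ρ y) (by
      filter_upwards [hR] with θ hθ
      rw [gdens_eq]
      gcongr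
      rw [neg_div, neg_le_neg_iff, Finset.sum_div]
      refine Finset.sum_le_sum fun t _ => ?_
      have h1 : (mn a θ t) ^ 2 ≤ R ^ 2 := sq_le_sq' (by linarith [abs_le.1 (hθ t)])
        (abs_le.1 (hθ t)).2
      nlinarith [sq_nonneg (y t + mn a θ t)])
  simpa [pbar] using this

lemma integrable_log_pbar {d n : ℕ} (a : Fin n → Fin d → ℝ) (ρ : Measure (Fin d → ℝ))
    [IsProbabilityMeasure ρ] (R : ℝ) (hR : ∀ᵐ θ ∂ρ, ∀ t, |mn a θ t| ≤ R) (m : Fin n → ℝ) :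
    Integrable (fun y => Real.log (gdens m y) - Real.log (pbar a ρ y))
      (Measure.pi fun t => gaussianReal (m t) 1) := by
  have hb : Integrable (fun y : Fin n → ℝ => (∑ t, (y t - m t) ^ 2) / 2 +
      (∑ t, (y t - (fun _ => (0:ℝ)) t) ^ 2 + n * R ^ 2))
      (Measure.pi fun t => gaussianReal (m t) 1) :=
    ((integrable_quad m m).div_const 2).add ((integrable_quad m fun _ => 0).add
      (integrable_const _))
  refine hb.mono' ((measurable_gdens_right m).log.sub
    (measurable_pbar a ρ).log).aestronglyMeasurable (Filter.Eventually.of_forall fun y => ?_)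
  have hc : 0 < ((Real.sqrt (2 * Real.pi))⁻¹) ^ n := by positivity
  have h1 := le_pbar a ρ R hR y
  have h0 : 0 < pbar a ρ y := lt_of_lt_of_le (by positivity) h1
  have h2 := Real.log_le_log (by positivity) h1
  have h3 := Real.log_le_log h0 (pbar_le a ρ y)
  rw [Real.log_mul hc.ne' (by positivity), Real.log_exp, Finset.sum_add_distrib] at h2
  simp only [Finset.sum_const, Finset.card_univ, Fintype.card_fin, nsmul_eq_mul] at h2
  have h4 : 0 ≤ ∑ t, (y t - m t) ^ 2 := Finset.sum_nonneg fun _ _ => sq_nonneg _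
  have h5 : 0 ≤ ∑ t, (y t) ^ 2 := Finset.sum_nonneg fun _ _ => sq_nonneg _
  have h6 : 0 ≤ n * R ^ 2 := by positivity
  rw [log_gdens, Real.norm_eq_abs, abs_le]
  simp only [sub_zero]
  constructor <;> linarith

noncomputable def uwt {N : ℕ} (l x : ℝ) : Option (Bool × Fin N) → ℝ
  | none => 1
  | some p => l * Real.exp (-x) ^ (p.2 : ℕ)

noncomputable def vval {N : ℕ} (η : ℝ) : Option (Bool × Fin N) → ℝ
  | none => 0
  | some p => if p.1 then (p.2 : ℕ) * η else -((p.2 : ℕ) * η)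

lemma uwt_pos {N : ℕ} (l x : ℝ) (hl : 0 < l) (k : Option (Bool × Fin N)) : 0 < uwt l x k := by
  cases k <;> simp only [uwt] <;> positivity

lemma sum_uwt {N : ℕ} (l x : ℝ) (hl : 0 < l) (hx : 0 < x) :
    ∑ k : Option (Bool × Fin N), uwt l x k ≤ 1 + 2 * l * (1 + 1 / x) := by
  rw [Fintype.sum_option, Fintype.sum_prod_type]
  simp only [uwt, Fintype.sum_bool, ← Finset.mul_sum]
  have h0 : Real.exp (-x) < 1 := by rw [Real.exp_lt_one_iff]; linarith
  have hs : ∑ i : Fin N, Real.exp (-x) ^ (i : ℕ) ≤ 1 + 1 / x := by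
    rw [Fin.sum_univ_eq_sum_range (fun i => Real.exp (-x) ^ i) N]
    have h1 : ∑ i ∈ Finset.range N, Real.exp (-x) ^ i ≤ (1 - Real.exp (-x))⁻¹ := by
      rw [← tsum_geometric_of_lt_one (Real.exp_pos _).le h0]
      exact (summable_geometric_of_lt_one (Real.exp_pos _).le h0).sum_le_tsum _
        (fun i _ => by positivity)
    refine h1.trans ?_
    rw [inv_le_comm₀ (by linarith) (by positivity)]
    have h2 : Real.exp (-x) ≤ (1 + x)⁻¹ := by
      rw [Real.exp_neg]
      exact inv_anti₀ (by positivity) (by linarith [Real.add_one_le_exp x])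
    have h3 : (1 + 1 / x)⁻¹ = 1 - (1 + x)⁻¹ := by
      have : 1 + x ≠ 0 := by positivity
      have : x + 1 ≠ 0 := by positivity
      field_simp
      ring
    linarith
  nlinarith

lemma sum_prod_uwt {N d : ℕ} (l x : ℝ) (hl : 0 < l) (hx : 0 < x) :
    ∑ k : Fin d → Option (Bool × Fin N), ∏ i, uwt l x (k i)
      ≤ (1 + 2 * l * (1 + 1 / x)) ^ d := by
  have h := Finset.prod_univ_sum (fun _ : Fin d => (Finset.univ : Finset (Option (Bool × Fin N))))
    (fun _ k => uwt l x k)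
  rw [Fintype.piFinset_univ] at h
  rw [← h, Finset.prod_const, Finset.card_univ, Fintype.card_fin]
  exact pow_le_pow_left₀ (Finset.sum_nonneg fun k _ => (uwt_pos l x hl k).le) (sum_uwt l x hl hx) _

/-- rounding of one coordinate -/
lemma round_coord {N : ℕ} (l x η z : ℝ) (hη : 0 < η) (hl : 0 < l) (hx : 0 < x)
    (hN : |z| / η < N) (hz : z ≠ 0) :
    ∃ k : Option (Bool × Fin N), |z - vval η k| ≤ η ∧
      Real.log l - x * (|z| / η) ≤ Real.log (uwt l x k) := by
  have h0 : 0 ≤ |z| / η := by positivity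
  have hf := Nat.floor_le h0
  have hf2 := Nat.lt_floor_add_one (|z| / η)
  rw [le_div_iff₀ hη] at hf
  rw [div_lt_iff₀ hη] at hf2
  refine ⟨some (decide (0 ≤ z), ⟨⌊|z| / η⌋₊, (Nat.floor_lt h0).2 hN⟩), ?_, ?_⟩
  · simp only [vval, decide_eq_true_eq]
    split_ifs with h
    · rw [abs_of_nonneg h] at *
      rw [abs_le]; constructor <;> nlinarith
    · rw [abs_of_neg (not_le.1 h)] at *
      rw [abs_le]; constructor <;> nlinarith
  · simp only [uwt]
    rw [Real.log_mul hl.ne' (by positivity), Real.log_pow, Real.log_exp]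
    have := Nat.floor_le h0
    nlinarith

lemma round_vec {N d n s : ℕ} (hs : 1 ≤ s) (hn : 1 ≤ n) (a : Fin n → Fin d → ℝ)
    (ha : ∀ t j, |a t j| ≤ 1) (l : ℝ) (hl : 0 < l) (hl1 : l ≤ 1)
    (hN : Real.sqrt (n * s) < N) (θ : Fin d → ℝ)
    (hθ : (∃ T : Finset (Fin d), T.card ≤ s ∧ ∀ i ∉ T, θ i = 0) ∧
      Real.sqrt (∑ i, (θ i) ^ 2) ≤ 1) :
    ∃ k : Fin d → Option (Bool × Fin N),
      (∑ t, (mn a θ t - mn a (fun i => vval (1 / Real.sqrt (n * s)) (k i)) t) ^ 2 ≤ s) ∧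
      s * Real.log l - s ≤ Real.log (∏ i, uwt l (1 / Real.sqrt n) (k i)) := by
  obtain ⟨⟨T, hT, hT0⟩, hnorm⟩ := hθ
  have hs0 : (0:ℝ) < s := by exact_mod_cast hs
  have hn0 : (0:ℝ) < n := by exact_mod_cast hn
  set η := 1 / Real.sqrt (n * s) with hη
  set x := 1 / Real.sqrt n with hx
  have hη0 : 0 < η := by positivity
  have hx0 : 0 < x := by positivity
  have hsq : ∑ i, (θ i) ^ 2 ≤ 1 := by
    rw [Real.sqrt_le_left (by norm_num)] at hnorm
    simpa using hnorm
  have h1 : ∀ i, |θ i| ≤ 1 := by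
    intro i
    have := Finset.single_le_sum (f := fun i => (θ i) ^ 2) (fun i _ => sq_nonneg _)
      (Finset.mem_univ i)
    rw [← sq_le_one_iff_abs_le_one]
    exact this.trans hsq
  have hi : ∀ i, |θ i| / η < N := by
    intro i
    rw [hη, div_div_eq_mul_div, div_one]
    refine lt_of_le_of_lt ?_ hN
    exact mul_le_of_le_one_left (by positivity) (h1 i)
  have hk : ∀ i, ∃ k : Option (Bool × Fin N), |θ i - vval η k| ≤ (if i ∈ T then η else 0) ∧
      (if i ∈ T then Real.log l - x * (|θ i| / η) else 0) ≤ Real.log (uwt l x k) := by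
    intro i
    by_cases h : θ i = 0
    · refine ⟨none, ?_, ?_⟩
      · simp only [h, vval]; split_ifs <;> simp [hη0.le]
      · simp only [h, uwt]
        split_ifs
        · simp [Real.log_nonpos hl.le hl1]
        · simp
    · have hiT : i ∈ T := by by_contra hc; exact h (hT0 i hc)
      simp only [hiT, if_true]
      exact round_coord l x η (θ i) hη0 hl hx0 (hi i) h
  choose k hk1 hk2 using hk
  have hTs : (T.card : ℝ) ≤ s := by exact_mod_cast hT
  refine ⟨k, ?_, ?_⟩
  · have ht : ∀ t, (mn a θ t - mn a (fun i => vval η (k i)) t) ^ 2 ≤ s / n := by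
      intro t
      have hb : |mn a θ t - mn a (fun i => vval η (k i)) t| ≤ s * η := by
        unfold mn
        rw [← Finset.sum_sub_distrib]
        calc |∑ i, (a t i * θ i - a t i * vval η (k i))|
            ≤ ∑ i, |a t i * θ i - a t i * vval η (k i)| := Finset.abs_sum_le_sum_abs _ _
          _ ≤ ∑ i, (if i ∈ T then η else 0) := by
              refine Finset.sum_le_sum fun i _ => ?_
              rw [← mul_sub, abs_mul]
              exact (mul_le_of_le_one_left (abs_nonneg _) (ha t i)).trans (hk1 i)
          _ = T.card * η := by simp
          _ ≤ s * η := by gcongr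
      have h2 := sq_le_sq' (by linarith [abs_le.1 hb]) (abs_le.1 hb).2
      refine h2.trans_eq ?_
      rw [mul_pow, hη, div_pow, Real.sq_sqrt (by positivity)]
      field_simp
    refine (Finset.sum_le_sum fun t _ => ht t).trans_eq ?_
    simp
    field_simp
  · rw [Real.log_prod (fun i _ => (uwt_pos l x hl (k i)).ne')]
    refine le_trans ?_ (Finset.sum_le_sum fun i _ => hk2 i)
    rw [Finset.sum_ite_mem, Finset.univ_inter, Finset.sum_sub_distrib, Finset.sum_const,
      nsmul_eq_mul, ← Finset.mul_sum, ← Finset.sum_div]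
    have hcs : ∑ i ∈ T, |θ i| ≤ Real.sqrt s := by
      apply Real.le_sqrt_of_sq_le
      refine (sq_sum_le_card_mul_sum_sq).trans ?_
      have : ∑ i ∈ T, |θ i| ^ 2 ≤ 1 := by
        simp only [sq_abs]
        exact (Finset.sum_le_univ_sum_of_nonneg fun i => sq_nonneg _).trans hsq
      have h0 : 0 ≤ ∑ i ∈ T, |θ i| ^ 2 := Finset.sum_nonneg fun _ _ => sq_nonneg _
      nlinarith
    have hA : x * ((∑ i ∈ T, |θ i|) / η) ≤ s := by
      have : x * (Real.sqrt s / η) = s := by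
        rw [hx, hη, Real.sqrt_mul hn0.le]
        field_simp
        exact Real.sq_sqrt hs0.le
      rw [← this]
      gcongr
    have hB : s * Real.log l ≤ T.card * Real.log l :=
      mul_le_mul_of_nonpos_right hTs (Real.log_nonpos hl.le hl1)
    linarith

noncomputable def qmix {d n : ℕ} (N : ℕ) (a : Fin n → Fin d → ℝ) (s l x η : ℝ)
    (y : Fin n → ℝ) : ℝ :=
  ∑ k : Fin d → Option (Bool × Fin N), Real.exp (-s) * (∏ i, uwt l x (k i)) *
    gdens (mn a (fun i => vval η (k i))) y

lemma measurable_qmix {d n : ℕ} (N : ℕ) (a : Fin n → Fin d → ℝ) (s l x η : ℝ) :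
    Measurable (qmix N a s l x η) := by
  unfold qmix
  exact Finset.measurable_fun_sum _ fun k _ => (measurable_gdens_right _).const_mul _

lemma wt_pos {d N : ℕ} (s l x : ℝ) (hl : 0 < l) (k : Fin d → Option (Bool × Fin N)) :
    0 < Real.exp (-s) * ∏ i, uwt l x (k i) :=
  mul_pos (Real.exp_pos _) (Finset.prod_pos fun i _ => uwt_pos l x hl (k i))

lemma qmix_nonneg {d n : ℕ} (N : ℕ) (a : Fin n → Fin d → ℝ) (s l x η : ℝ) (hl : 0 < l)
    (y : Fin n → ℝ) : 0 ≤ qmix N a s l x η y :=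
  Finset.sum_nonneg fun k _ => (mul_pos (wt_pos s l x hl k) (gdens_pos _ _)).le

lemma lintegral_qmix {d n : ℕ} (N : ℕ) (a : Fin n → Fin d → ℝ) (s l x η : ℝ) (hl : 0 < l)
    (hx : 0 < x) (h : (1 + 2 * l * (1 + 1 / x)) ^ d ≤ Real.exp s) :
    ∫⁻ y, ENNReal.ofReal (qmix N a s l x η y) ≤ 1 := by
  unfold qmix
  have e : ∀ y : Fin n → ℝ, ENNReal.ofReal (∑ k : Fin d → Option (Bool × Fin N),
      Real.exp (-s) * (∏ i, uwt l x (k i)) * gdens (mn a (fun i => vval η (k i))) y) =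
      ∑ k : Fin d → Option (Bool × Fin N), ENNReal.ofReal (Real.exp (-s) * (∏ i, uwt l x (k i))) *
        ENNReal.ofReal (gdens (mn a (fun i => vval η (k i))) y) := by
    intro y
    rw [ENNReal.ofReal_sum_of_nonneg
      (fun k _ => (mul_pos (wt_pos s l x hl k) (gdens_pos _ _)).le)]
    exact Finset.sum_congr rfl fun k _ => ENNReal.ofReal_mul (wt_pos s l x hl k).le
  simp_rw [e]
  rw [lintegral_finsetSum _ fun k _ =>
    ((measurable_gdens_right _).ennreal_ofReal.const_mul _)]
  have e2 : ∀ k : Fin d → Option (Bool × Fin N),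
      ∫⁻ y, ENNReal.ofReal (Real.exp (-s) * (∏ i, uwt l x (k i))) *
        ENNReal.ofReal (gdens (mn a (fun i => vval η (k i))) y) =
      ENNReal.ofReal (Real.exp (-s) * (∏ i, uwt l x (k i))) := by
    intro k
    rw [lintegral_const_mul _ (measurable_gdens_right _).ennreal_ofReal, lintegral_gdens, mul_one]
  simp_rw [e2]
  rw [← ENNReal.ofReal_sum_of_nonneg (fun k _ => (wt_pos s l x hl k).le), ← Finset.mul_sum,
    ← ENNReal.ofReal_one]
  apply ENNReal.ofReal_le_ofReal
  have h1 := (sum_prod_uwt (N := N) (d := d) l x hl hx).trans h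
  calc _ ≤ Real.exp (-s) * Real.exp s := by gcongr
    _ = 1 := by rw [← Real.exp_add]; simp

lemma const_bound (s d n : ℕ) (hs : 1 ≤ s) (hsd : s ≤ d) (hn : 1 ≤ n) :
    (s:ℝ) / 2 + 2 * s - s * Real.log (s / (4 * d * Real.sqrt n)) ≤
      2 * s * Real.log (3 * Real.exp 1 * d * Real.sqrt n / s) := by
  have hs0 : (0:ℝ) < s := by exact_mod_cast hs
  have hd0 : (0:ℝ) < d := by exact_mod_cast (hs.trans hsd)
  have hn1 : (1:ℝ) ≤ Real.sqrt n := by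
    rw [Real.one_le_sqrt]; exact_mod_cast hn
  have hz1 : 1 ≤ d * Real.sqrt n / s := by
    rw [le_div_iff₀ hs0]
    have : (s:ℝ) ≤ d := by exact_mod_cast hsd
    nlinarith
  set z := d * Real.sqrt n / s with hz
  have e1 : (s:ℝ) / (4 * d * Real.sqrt n) = (4 * z)⁻¹ := by
    rw [hz]; field_simp
  have e2 : 3 * Real.exp 1 * d * Real.sqrt n / s = 3 * Real.exp 1 * z := by
    rw [hz]; ring
  rw [e1, e2, Real.log_inv, Real.log_mul (by norm_num) (by positivity),
    Real.log_mul (by positivity) (by positivity), Real.log_mul (by positivity) (by positivity),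
    Real.log_exp]
  have hlz := Real.log_nonneg hz1
  have h94 : 1 / 2 + Real.log 4 ≤ 2 * Real.log 3 := by
    have : 1 + 2 * Real.log 4 ≤ 4 * Real.log 3 := by
      have e : 1 + 2 * Real.log 4 = Real.log (Real.exp 1 * 4 ^ 2) := by
        rw [Real.log_mul (by positivity) (by positivity), Real.log_exp, Real.log_pow]; simp
      have e' : 4 * Real.log 3 = Real.log (3 ^ 4) := by rw [Real.log_pow]; simp
      rw [e, e']
      apply Real.log_le_log (by positivity)
      have := Real.exp_one_lt_d9
      norm_num at this ⊢
      linarith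
    linarith
  nlinarith

/-- Lemma 3 for a fixed action sequence: for any prior `ρ` supported on the `s`-sparse
vectors in the unit ball, the mutual information between the parameter and the `n`
Gaussian observations — the average KL divergence from the conditional laws `P_θ` to the
Bayes mixture `P̄ = ρ.bind P` — is at most `2 s log(3e d √n / s)`. -/
theorem mutual_information_sparse_linear_bound
    (s d n : ℕ) (hs : 1 ≤ s) (hsd : s ≤ d) (hn : 1 ≤ n)
    (a : Fin n → Fin d → ℝ) (ha : ∀ t j, |a t j| ≤ 1)
    (ρ : Measure (Fin d → ℝ)) (hρ : IsProbabilityMeasure ρ)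
    (hsupp : ρ {θ | ¬ ((∃ T : Finset (Fin d), T.card ≤ s ∧ ∀ i ∉ T, θ i = 0) ∧
      Real.sqrt (∑ i, (θ i) ^ 2) ≤ 1)} = 0) :
    ∫⁻ θ, klDiv (obsLaw a θ) (ρ.bind (obsLaw a)) ∂ρ ≤
      ENNReal.ofReal (2 * s * Real.log (3 * Real.exp 1 * d * Real.sqrt n / s)) := by
  have hs0 : (0:ℝ) < s := by exact_mod_cast hs
  have hd0 : (0:ℝ) < d := by exact_mod_cast (hs.trans hsd)
  have hsd' : (s:ℝ) ≤ d := by exact_mod_cast hsd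
  have hn1 : (1:ℝ) ≤ Real.sqrt n := by
    rw [Real.one_le_sqrt]; exact_mod_cast hn
  obtain ⟨N, hN⟩ := exists_nat_gt (Real.sqrt (n * s))
  set l : ℝ := s / (4 * d * Real.sqrt n) with hl
  set x : ℝ := 1 / Real.sqrt n with hx
  set η : ℝ := 1 / Real.sqrt (n * s) with hη
  have hl0 : 0 < l := by positivity
  have hl1 : l ≤ 1 := by
    rw [hl, div_le_one (by positivity)]
    nlinarith
  have hx0 : 0 < x := by positivity
  have hmass : (1 + 2 * l * (1 + 1 / x)) ^ d ≤ Real.exp s := by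
    have h1 : 1 + 2 * l * (1 + 1 / x) ≤ Real.exp (s / d) := by
      have h2 : 2 * l * (1 + 1 / x) ≤ s / d := by
        rw [hx, one_div_one_div]
        have h3 : 2 * l * (1 + Real.sqrt n) ≤ 2 * l * (2 * Real.sqrt n) := by
          gcongr; linarith
        refine h3.trans_eq ?_
        rw [hl]; field_simp; norm_num
      linarith [Real.add_one_le_exp ((s:ℝ) / d)]
    refine (pow_le_pow_left₀ (by positivity) h1 d).trans_eq ?_
    rw [← Real.exp_nat_mul]
    congr 1
    field_simp
  have hsupp' : ∀ᵐ θ ∂ρ, (∃ T : Finset (Fin d), T.card ≤ s ∧ ∀ i ∉ T, θ i = 0) ∧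
      Real.sqrt (∑ i, (θ i) ^ 2) ≤ 1 := hsupp
  have hR : ∀ᵐ θ ∂ρ, ∀ t, |mn a θ t| ≤ d := by
    filter_upwards [hsupp'] with θ hθ t
    have hsq : ∑ i, (θ i) ^ 2 ≤ 1 := by
      have := hθ.2
      rw [Real.sqrt_le_left (by norm_num)] at this
      simpa using this
    have h1 : ∀ i, |θ i| ≤ 1 := by
      intro i
      have := Finset.single_le_sum (f := fun i => (θ i) ^ 2) (fun i _ => sq_nonneg _)
        (Finset.mem_univ i)
      rw [← sq_le_one_iff_abs_le_one]
      exact this.trans hsq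
    unfold mn
    calc |∑ i, a t i * θ i| ≤ ∑ i, |a t i * θ i| := Finset.abs_sum_le_sum_abs _ _
      _ ≤ ∑ _i : Fin d, (1:ℝ) := by
        refine Finset.sum_le_sum fun i _ => ?_
        rw [abs_mul]
        exact mul_le_one₀ (ha t i) (abs_nonneg _) (h1 i)
      _ = d := by simp
  have hp0 : ∀ y, 0 < pbar a ρ y := fun y =>
    lt_of_lt_of_le (by positivity) (le_pbar a ρ d hR y)
  have hbp := bind_prob a ρ
  set B : ℝ := (s:ℝ) / 2 + 2 * s - s * Real.log l with hB
  have hB0 : 0 ≤ B := by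
    have := Real.log_nonpos hl0.le hl1
    rw [hB]
    nlinarith
  have key : ∀ᵐ θ ∂ρ, klDiv (obsLaw a θ) (ρ.bind (obsLaw a)) + 1 ≤ ENNReal.ofReal B +
      ∫⁻ y, ENNReal.ofReal (qmix N a s l x η y / pbar a ρ y) ∂(obsLaw a θ) := by
    filter_upwards [hsupp'] with θ hθ
    obtain ⟨k, hk1, hk2⟩ := round_vec hs hn a ha l hl0 hl1 hN θ hθ
    set m' := mn a (fun i => vval η (k i)) with hm'
    set w := Real.exp (-s) * ∏ i, uwt l x (k i) with hw
    have hw0 : 0 < w := wt_pos s l x hl0 k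
    have hlogw : s * Real.log l - 2 * s ≤ Real.log w := by
      rw [hw, Real.log_mul (Real.exp_pos _).ne'
        (Finset.prod_pos fun i _ => uwt_pos l x hl0 (k i)).ne', Real.log_exp]
      linarith
    have hri : Integrable (fun y => Real.log (gdens (mn a θ) y) - Real.log (gdens m' y))
      (obsLaw a θ) := integrable_log_ratio (mn a θ) m'
    refine kl_core volume (obsLaw a θ) (ρ.bind (obsLaw a)) (gdens (mn a θ)) (pbar a ρ)
      (qmix N a s l x η)
      (fun y => (Real.log (gdens (mn a θ) y) - Real.log (gdens m' y)) + (-Real.log w))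
      (measurable_gdens_right _) (measurable_pbar a ρ) (measurable_qmix N a s l x η)
      (gdens_pos _) hp0 (qmix_nonneg N a s l x η hl0) (obsLaw_eq a θ) (bind_eq a ρ)
      (integrable_log_pbar a ρ d hR (mn a θ)) (hri.add (integrable_const _)) ?_ B hB0 ?_
    · intro y
      have hq : w * gdens m' y ≤ qmix N a s l x η y :=
        Finset.single_le_sum (f := fun k : Fin d → Option (Bool × Fin N) =>
          Real.exp (-s) * (∏ i, uwt l x (k i)) * gdens (mn a (fun i => vval η (k i))) y)
          (fun k _ => (mul_pos (wt_pos s l x hl0 k) (gdens_pos _ _)).le) (Finset.mem_univ k)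
      have hwp : 0 < w * gdens m' y := mul_pos hw0 (gdens_pos _ _)
      have h1 := Real.log_le_sub_one_of_pos (div_pos hwp (hp0 y))
      rw [Real.log_div hwp.ne' (hp0 y).ne', Real.log_mul hw0.ne' (gdens_pos _ _).ne'] at h1
      have h2 : w * gdens m' y / pbar a ρ y ≤ qmix N a s l x η y / pbar a ρ y :=
        div_le_div_of_nonneg_right hq (hp0 y).le
      linarith
    · rw [integral_add hri (integrable_const _)]
      have h1 : ∫ y, (Real.log (gdens (mn a θ) y) - Real.log (gdens m' y)) ∂(obsLaw a θ) =
        (∑ t, (mn a θ t - m' t) ^ 2) / 2 := integral_log_ratio (mn a θ) m'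
      rw [h1]
      simp only [integral_const, probReal_univ, one_smul]
      linarith
  have hfin : ∫⁻ θ, klDiv (obsLaw a θ) (ρ.bind (obsLaw a)) ∂ρ + 1 ≤ ENNReal.ofReal B + 1 := by
    have e1 : ∫⁻ θ, klDiv (obsLaw a θ) (ρ.bind (obsLaw a)) ∂ρ + 1 =
        ∫⁻ θ, (klDiv (obsLaw a θ) (ρ.bind (obsLaw a)) + 1) ∂ρ := by
      rw [lintegral_add_right _ measurable_const]; simp
    have hmeas : Measurable fun y => ENNReal.ofReal (qmix N a s l x η y / pbar a ρ y) :=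
      ((measurable_qmix N a s l x η).div (measurable_pbar a ρ)).ennreal_ofReal
    rw [e1]
    refine (lintegral_mono_ae key).trans ?_
    rw [lintegral_add_left measurable_const,
      ← Measure.lintegral_bind (measurable_obsLaw a).aemeasurable hmeas.aemeasurable,
      bind_eq, lintegral_withDensity_eq_lintegral_mul _ (measurable_pbar a ρ).ennreal_ofReal hmeas]
    have e2 : ∀ y, ((fun y => ENNReal.ofReal (pbar a ρ y)) *
        fun y => ENNReal.ofReal (qmix N a s l x η y / pbar a ρ y)) y =
        ENNReal.ofReal (qmix N a s l x η y) := by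
      intro y
      simp only [Pi.mul_apply]
      rw [← ENNReal.ofReal_mul (hp0 y).le, mul_div_cancel₀ _ (hp0 y).ne']
    simp_rw [e2]
    simp only [lintegral_const, measure_univ, mul_one]
    gcongr
    exact lintegral_qmix N a s l x η hl0 hx0 hmass
  have h1 := (ENNReal.add_le_add_iff_right ENNReal.one_ne_top).1 hfin
  exact h1.trans (ENNReal.ofReal_le_ofReal (const_bound s d n hs hsd hn))
end
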